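/- Let A be a graded normal degenerate even tensor with respect to Z = diag(I_{D_e}, −I_{D_o}). Then D_e = D_o = D/2, and there exists an invertible matrix Y ∈ M_D(ℂ) with Y Z = Z Y such that, identifying ℂ^D = ℂ² ⊗ ℂ^{D/2} so that Z = σ^z ⊗ I_{D/2}, one has Y A^i Y^{−1} = (σ^x)^{|i|} ⊗ B^i for some matrices B^i ∈ M_{D/2}(ℂ); moreover there exist indices i and j with |i| = 1 and |j| = 0 such that B^i ≠ 0 and B^j ≠ 0. -/

import Mathlib

open Matrix Kronecker
open scoped ComplexOrder

namespace FQCA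

noncomputable section

/-- The sign `(-1)^x` associated with a parity `x ∈ ℤ₂`. -/
def sgn (x : ZMod 2) : ℂ := (-1 : ℂ) ^ x.val

/-- Entrywise complex conjugation of a matrix. -/
def mconj {m n : Type*} (A : Matrix m n ℂ) : Matrix m n ℂ := A.map (starRingEnd ℂ)

/-- A diagonal matrix with diagonal entries `±1`. -/
def IsParityMatrix {ν : Type*} (Z : Matrix ν ν ℂ) : Prop :=
  Z.IsDiag ∧ ∀ α, Z α α = 1 ∨ Z α α = -1

/-- An even tensor: `Z * A i = (-1)^{|i|} A i * Z`. -/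
def EvenTensor {ι ν : Type*} [Fintype ν] (p : ι → ZMod 2)
    (A : ι → Matrix ν ν ℂ) (Z : Matrix ν ν ℂ) : Prop :=
  ∀ i, Z * A i = sgn (p i) • (A i * Z)

/-- The transfer matrix `E_A = Σ_i A^i ⊗ conj (A^i)`. -/
def transfer {ι ν : Type*} [Fintype ι] (A : ι → Matrix ν ν ℂ) :
    Matrix (ν × ν) (ν × ν) ℂ :=
  ∑ i, (A i) ⊗ₖ (mconj (A i))

/-- `P` is the orthogonal projector of a nonzero proper graded invariant subspace for `A`. -/
def GradedInvariantProj {ι ν : Type*} [Fintype ν] [DecidableEq ν]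
    (A : ι → Matrix ν ν ℂ) (Z P : Matrix ν ν ℂ) : Prop :=
  P * P = P ∧ Pᴴ = P ∧ P ≠ 0 ∧ P ≠ 1 ∧ P * Z = Z * P ∧ ∀ i, A i * P = P * (A i * P)

/-- A graded irreducible tensor: no nonzero proper graded invariant subspace. -/
def GradedIrreducible {ι ν : Type*} [Fintype ν] [DecidableEq ν]
    (A : ι → Matrix ν ν ℂ) (Z : Matrix ν ν ℂ) : Prop :=
  ¬ ∃ P, GradedInvariantProj A Z P

/-- A graded normal tensor, `mult = 1` (non-degenerate) or `2` (degenerate):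
graded irreducible, `1` is an eigenvalue of the transfer matrix of algebraic multiplicity
`mult`, and all other eigenvalues have modulus `< 1`. -/
def GradedNormal {ι ν : Type*} [Fintype ι] [Fintype ν] [DecidableEq ν]
    (A : ι → Matrix ν ν ℂ) (Z : Matrix ν ν ℂ) (mult : ℕ) : Prop :=
  GradedIrreducible A Z ∧
  (Matrix.charpoly (transfer A)).rootMultiplicity 1 = mult ∧
  ∀ μ ∈ spectrum ℂ (transfer A), μ ≠ 1 → ‖μ‖ < 1

/-- Graded Canonical Form: `A^i = ⊕ₖ μₖ Aₖ^i` with `Z` block diagonal in the same way and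
every block a graded normal tensor. -/
def GCF {ι ν : Type*} [Fintype ι] [Fintype ν] [DecidableEq ν]
    (p : ι → ZMod 2) (A : ι → Matrix ν ν ℂ) (Z : Matrix ν ν ℂ) : Prop :=
  ∃ (g : ℕ) (Dk : Fin g → ℕ) (e : ν ≃ ((k : Fin g) × Fin (Dk k)))
    (μ : Fin g → ℂ)
    (Ak : (k : Fin g) → ι → Matrix (Fin (Dk k)) (Fin (Dk k)) ℂ)
    (Zk : (k : Fin g) → Matrix (Fin (Dk k)) (Fin (Dk k)) ℂ),
    0 < g ∧
    (∀ i, Matrix.reindex e e (A i) = Matrix.blockDiagonal' (fun k => μ k • Ak k i)) ∧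
    Matrix.reindex e e Z = Matrix.blockDiagonal' Zk ∧
    ∀ k, IsParityMatrix (Zk k) ∧ EvenTensor p (Ak k) (Zk k) ∧
      (GradedNormal (Ak k) (Zk k) 1 ∨ GradedNormal (Ak k) (Zk k) 2)

/-- The coefficient `tr(A^{n₁} ⋯ A^{n_N})` of the fMPS with antiperiodic boundary
conditions generated by the tensor `A`. -/
def mpsCoeff {ι ν : Type*} [Fintype ν] [DecidableEq ν] {N : ℕ}
    (A : ι → Matrix ν ν ℂ) (n : Fin N → ι) : ℂ :=
  ((List.ofFn fun j => A (n j)).prod).trace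

/-- The fermionic sign `σ(n,m) = Σ_{k<j} (|n_j|+|m_j|)·|m_k|` of an fMPO matrix element. -/
def mpoSign {ι : Type*} (p : ι → ZMod 2) {N : ℕ} (n m : Fin N → ι) : ZMod 2 :=
  ∑ jk ∈ Finset.univ.filter (fun jk : Fin N × Fin N => jk.2 < jk.1),
    (p (n jk.1) + p (m jk.1)) * p (m jk.2)

/-- The fMPO with antiperiodic boundary conditions generated by the MPO tensor `U`. -/
def fMPO {ι : Type*} (p : ι → ZMod 2) {ν : Type*} [Fintype ν] [DecidableEq ν]
    (U : ι → ι → Matrix ν ν ℂ) (N : ℕ) :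
    Matrix (Fin N → ι) (Fin N → ι) ℂ :=
  Matrix.of fun n m =>
    sgn (mpoSign p n m) * ((List.ofFn fun j => U (n j) (m j)).prod).trace

/-- The fMPO with periodic boundary conditions generated by the MPO tensor `U`
(parity operator `Z` inserted in the trace). -/
def fMPO_PBC {ι : Type*} (p : ι → ZMod 2) {ν : Type*} [Fintype ν] [DecidableEq ν]
    (Z : Matrix ν ν ℂ) (U : ι → ι → Matrix ν ν ℂ) (N : ℕ) :
    Matrix (Fin N → ι) (Fin N → ι) ℂ :=
  Matrix.of fun n m =>
    sgn (mpoSign p n m) * (Z * (List.ofFn fun j => U (n j) (m j)).prod).trace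

/-- The fermionic blocking sign `τ(n,m) = Σ_{j<l} |m_j|·(|n_l|+|m_l|)`. -/
def blockSign {ι : Type*} (p : ι → ZMod 2) {q : ℕ} (n m : Fin q → ι) : ZMod 2 :=
  ∑ jl ∈ Finset.univ.filter (fun jl : Fin q × Fin q => jl.1 < jl.2),
    p (m jl.1) * (p (n jl.2) + p (m jl.2))

/-- The `q`-fold blocked MPO tensor, with the fermionic blocking signs. -/
def blocked {ι : Type*} (p : ι → ZMod 2) {ν : Type*} [Fintype ν] [DecidableEq ν]
    (U : ι → ι → Matrix ν ν ℂ) (q : ℕ) :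
    (Fin q → ι) → (Fin q → ι) → Matrix ν ν ℂ :=
  fun n m => sgn (blockSign p n m) • ((List.ofFn fun j => U (n j) (m j)).prod)

/-- The right rank `r(U)`: rank of the matrix with entry
`(-1)^{|n||m|} (U^{n,m})_{α,β}` in row `(n,β)` and column `(m,α)`. -/
def rightRank {ι ν : Type*} [Fintype ι] [Fintype ν]
    (p : ι → ZMod 2) (U : ι → ι → Matrix ν ν ℂ) : ℕ :=
  (Matrix.of fun (r c : ι × ν) => sgn (p r.1 * p c.1) * U r.1 c.1 c.2 r.2).rank

/-- The left rank `ℓ(U)`: rank of the matrix with entry `(U^{n,m})_{α,β}`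
in row `(n,α)` and column `(m,β)`. -/
def leftRank {ι ν : Type*} [Fintype ι] [Fintype ν]
    (U : ι → ι → Matrix ν ν ℂ) : ℕ :=
  (Matrix.of fun (r c : ι × ν) => U r.1 c.1 r.2 c.2).rank

/-- The Pauli matrix `σˣ`, indexed by `Bool`. -/
def pauliX : Matrix Bool Bool ℂ := Matrix.of fun a b => if a = b then 0 else 1

/-- The Pauli matrix `σᶻ`, indexed by `Bool`. -/
def pauliZ : Matrix Bool Bool ℂ := Matrix.diagonal (fun b => if b then -1 else 1)

/-- The single-site physical parity matrix `P = diag((-1)^{|i|})`. -/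
def singleP {ι : Type*} [DecidableEq ι] (p : ι → ZMod 2) : Matrix ι ι ℂ :=
  Matrix.diagonal (fun i => sgn (p i))

/-- The parity of the doubled physical index `(n,m)` of an MPO tensor. -/
def doubledP {ι : Type*} (p : ι → ZMod 2) : ι × ι → ZMod 2 :=
  fun nm => p nm.1 + p nm.2

/-- An MPO tensor regarded as a tensor in the doubled physical index. -/
def doubledT {ι ν : Type*} (U : ι → ι → Matrix ν ν ℂ) : ι × ι → Matrix ν ν ℂ :=
  fun nm => U nm.1 nm.2

/-- An MPO tensor rescaled by `c`, regarded as a tensor in the doubled physical index. -/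
def mpoScaled {ι ν : Type*} (c : ℂ) (U : ι → ι → Matrix ν ν ℂ) : ι × ι → Matrix ν ν ℂ :=
  fun nm => c • U nm.1 nm.2

/-- The parity operator `σᶻ ⊗ I` on the bond space `Bool × Fin b`. -/
def ZBP (b : ℕ) : Matrix (Bool × Fin b) (Bool × Fin b) ℂ :=
  pauliZ ⊗ₖ (1 : Matrix (Fin b) (Fin b) ℂ)

/-- Structure of a type II MPO tensor: `U^{n,m} = (σˣ)^{|n|+|m|} ⊗ N^{n,m}`. -/
def TypeIIStruct {d b : ℕ} (p : Fin d → ZMod 2)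
    (U : Fin d → Fin d → Matrix (Bool × Fin b) (Bool × Fin b) ℂ) : Prop :=
  ∃ Nm : Fin d → Fin d → Matrix (Fin b) (Fin b) ℂ,
    ∀ n m', U n m' = (pauliX ^ (p n + p m').val) ⊗ₖ Nm n m'

/-- The parity matrix of the product grading on `q` sites. -/
def bigP {d : ℕ} (p : Fin d → ZMod 2) (q : ℕ) :
    Matrix (Fin q → Fin d) (Fin q → Fin d) ℂ :=
  Matrix.diagonal (fun n => sgn (∑ i, p (n i)))

/-- The Jordan-Wigner embedding at site `j` of a local operator `O` homogeneous of
parity `o`: `P^{|O|} ⊗ ⋯ ⊗ P^{|O|} ⊗ O ⊗ I ⊗ ⋯ ⊗ I`. -/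
def jordanWigner {d N : ℕ} (p : Fin d → ZMod 2) (o : ZMod 2)
    (O : Matrix (Fin d) (Fin d) ℂ) (j : Fin N) :
    Matrix (Fin N → Fin d) (Fin N → Fin d) ℂ :=
  Matrix.of fun n m =>
    (∏ l ∈ Finset.univ.filter (fun l : Fin N => l < j),
      ((singleP p) ^ o.val) (n l) (m l)) *
    O (n j) (m j) *
    (∏ l ∈ Finset.univ.filter (fun l : Fin N => j < l),
      (if n l = m l then (1:ℂ) else 0))

/-- The identification `ℂ^{D_e} ⊕ ℂ^{D_o} ≃ ℂ² ⊗ ℂ^{D_e}` (given `D_o = D_e`), under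
which `Z = diag(I,-I)` becomes `σᶻ ⊗ I`. -/
def sumToBP {De Do : ℕ} (h : Do = De) : (Fin De ⊕ Fin Do) ≃ Bool × Fin De :=
  (Equiv.sumCongr (Equiv.refl (Fin De)) (finCongr h)).trans
    (Equiv.boolProdEquivSum (Fin De)).symm

/-- The completely positive map `X ↦ ∑ i, A i * X * (A i)ᴴ` with Kraus operators `A i`. -/
def krausMap {ι ν : Type*} [Fintype ι] [Fintype ν] (A : ι → Matrix ν ν ℂ) :
    Module.End ℂ (Matrix ν ν ℂ) where
  toFun X := ∑ i, A i * X * (A i)ᴴ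
  map_add' X Y := by simp [Matrix.mul_add, Matrix.add_mul, Finset.sum_add_distrib]
  map_smul' c X := by simp [Finset.smul_sum]

/-- Matrices as vectors indexed by pairs. -/
def pairVec (ν : Type*) : Matrix ν ν ℂ ≃ₗ[ℂ] (ν × ν → ℂ) where
  toFun X ab := X ab.1 ab.2
  invFun v := Matrix.of fun a b => v (a, b)
  map_add' _ _ := rfl
  map_smul' _ _ := rfl
  left_inv _ := rfl
  right_inv _ := rfl

theorem pairVec_apply {ν : Type*} (X : Matrix ν ν ℂ) (ab : ν × ν) :
    pairVec ν X ab = X ab.1 ab.2 := rfl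

section Kraus

variable {ι ν : Type*} [Fintype ι] [Fintype ν] (A : ι → Matrix ν ν ℂ)

theorem krausMap_apply (X : Matrix ν ν ℂ) : krausMap A X = ∑ i, A i * X * (A i)ᴴ := rfl

theorem krausMap_conjTranspose (X : Matrix ν ν ℂ) : krausMap A Xᴴ = (krausMap A X)ᴴ := by
  simp [krausMap_apply, Matrix.conjTranspose_sum, Matrix.mul_assoc]

theorem krausMap_posSemidef {X : Matrix ν ν ℂ} (hX : X.PosSemidef) :
    (krausMap A X).PosSemidef := by
  rw [krausMap_apply]
  exact Matrix.posSemidef_sum _ fun i _ => hX.mul_mul_conjTranspose_same (A i)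

theorem krausMap_pow_posSemidef {X : Matrix ν ν ℂ} (hX : X.PosSemidef) (n : ℕ) :
    ((krausMap A ^ n) X).PosSemidef := by
  induction n with
  | zero => simpa using hX
  | succ n ih =>
    rw [pow_succ', Module.End.mul_apply]
    exact krausMap_posSemidef A ih

theorem pairVec_krausMap (X : Matrix ν ν ℂ) :
    pairVec ν (krausMap A X) = transfer A *ᵥ pairVec ν X := by
  ext ⟨a, b⟩
  rw [pairVec_apply, krausMap_apply, transfer, Matrix.sum_mulVec, Finset.sum_apply,
    Matrix.sum_apply]
  refine Finset.sum_congr rfl fun i _ => ?_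
  simp only [Matrix.mul_apply, Matrix.mulVec, dotProduct, Fintype.sum_prod_type,
    Matrix.kroneckerMap_apply, mconj, Matrix.map_apply, Matrix.conjTranspose_apply,
    Finset.sum_mul, pairVec_apply]
  rw [Finset.sum_comm]
  refine Finset.sum_congr rfl fun c _ => Finset.sum_congr rfl fun e _ => ?_
  simp only [Complex.star_def]
  ring

variable [DecidableEq ν]

theorem pairVec_conj_krausMap :
    (pairVec ν).conj (krausMap A) = Matrix.toLin' (transfer A) := by
  ext1 v
  ext1
  simp [LinearEquiv.conj_apply, pairVec_krausMap]

theorem charpoly_krausMap : (krausMap A).charpoly = (transfer A).charpoly := by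
  rw [← LinearEquiv.charpoly_conj (pairVec ν), pairVec_conj_krausMap, Matrix.charpoly_toLin']

theorem hasEigenvalue_krausMap_iff (μ : ℂ) :
    (krausMap A).HasEigenvalue μ ↔ μ ∈ spectrum ℂ (transfer A) := by
  rw [Module.End.hasEigenvalue_iff_isRoot_charpoly, charpoly_krausMap,
    Matrix.mem_spectrum_iff_isRoot_charpoly]

end Kraus

theorem tendsto_pow_zero_of_spectralRadius_lt_one {R : Type*} [NormedRing R] [NormedAlgebra ℂ R]
    [CompleteSpace R] {a : R} (ha : spectralRadius ℂ a < 1) :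
    Filter.Tendsto (fun n : ℕ => a ^ n) Filter.atTop (nhds 0) := by
  obtain ⟨c, hac, hc⟩ := ENNReal.lt_iff_exists_nnreal_btwn.mp ha
  have hc1 : c < 1 := by exact_mod_cast hc
  have key : ∀ᶠ n : ℕ in Filter.atTop, ‖a ^ n‖ ≤ (c : ℝ) ^ n := by
    have hev := (spectrum.pow_nnnorm_pow_one_div_tendsto_nhds_spectralRadius a).eventually_lt_const
      hac
    filter_upwards [hev, Filter.eventually_gt_atTop 0] with n hn hn0
    have hn0' : (n : ℝ) ≠ 0 := by positivity
    have h := ENNReal.rpow_le_rpow hn.le (Nat.cast_nonneg (α := ℝ) n)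
    rw [← ENNReal.rpow_mul, one_div, inv_mul_cancel₀ hn0', ENNReal.rpow_one,
      ENNReal.rpow_natCast] at h
    exact_mod_cast h
  exact squeeze_zero_norm' key (tendsto_pow_atTop_nhds_zero_of_lt_one c.2 (by exact_mod_cast hc1))

section PosSemidef

variable {ν : Type*}

theorem posSemidef_ofReal_smul {M : Matrix ν ν ℂ} (hM : M.PosSemidef) {c : ℝ} (hc : 0 ≤ c) :
    ((c : ℂ) • M).PosSemidef :=
  hM.smul (by exact_mod_cast hc)

theorem isHermitian_ofReal_smul {M : Matrix ν ν ℂ} (hM : M.IsHermitian) (c : ℝ) :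
    ((c : ℂ) • M).IsHermitian := by
  rw [Matrix.IsHermitian, Matrix.conjTranspose_smul, hM.eq]
  simp

variable [Fintype ν]

theorem posSemidef_of_re_nonneg {M : Matrix ν ν ℂ} (hM : M.IsHermitian)
    (h : ∀ x, 0 ≤ (star x ⬝ᵥ (M *ᵥ x)).re) : M.PosSemidef := by
  refine Matrix.PosSemidef.of_dotProduct_mulVec_nonneg hM fun x => ?_
  rw [Complex.nonneg_iff]
  exact ⟨h x, (hM.im_star_dotProduct_mulVec_self x).symm⟩

theorem re_dotProduct_nonneg {M : Matrix ν ν ℂ} (hM : M.PosSemidef) (x : ν → ℂ) :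
    0 ≤ (star x ⬝ᵥ (M *ᵥ x)).re :=
  (Complex.nonneg_iff.mp (hM.dotProduct_mulVec_nonneg x)).1

theorem isClosed_setOf_posSemidef : IsClosed {M : Matrix ν ν ℂ | M.PosSemidef} := by
  have : {M : Matrix ν ν ℂ | M.PosSemidef} =
      {M | Mᴴ = M} ∩ ⋂ x : ν → ℂ, {M | 0 ≤ (star x ⬝ᵥ (M *ᵥ x)).re} := by
    ext M
    simp only [Set.mem_inter_iff, Set.mem_ofPred_eq, Set.mem_iInter]
    exact ⟨fun h => ⟨h.1, re_dotProduct_nonneg h⟩, fun h => posSemidef_of_re_nonneg h.1 h.2⟩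
  rw [this]
  refine (isClosed_eq (by fun_prop) (by fun_prop)).inter (isClosed_iInter fun x => ?_)
  exact isClosed_le (by fun_prop) (by fun_prop)

theorem eq_zero_of_posSemidef_of_neg {M : Matrix ν ν ℂ} (h : M.PosSemidef)
    (h' : (-M).PosSemidef) : M = 0 := by
  classical
  refine Matrix.ext_of_mulVec_single fun i => ?_
  rw [Matrix.zero_mulVec, ← h.dotProduct_mulVec_zero_iff]
  refine le_antisymm ?_ (h.dotProduct_mulVec_nonneg _)
  have := h'.dotProduct_mulVec_nonneg (Pi.single i 1)
  rwa [Matrix.neg_mulVec, dotProduct_neg, neg_nonneg] at this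

/-- There is a largest real `m` with `m • ρ ≤ X`. -/
theorem exists_posSemidef_sub_smul [Nonempty ν] {X ρ : Matrix ν ν ℂ} (hX : X.IsHermitian)
    (hρ : ρ.PosDef) :
    ∃ m : ℝ, (X - (m : ℂ) • ρ).PosSemidef ∧ ∃ v ≠ 0, (X - (m : ℂ) • ρ) *ᵥ v = 0 := by
  have hpos : ∀ v ≠ 0, 0 < (star v ⬝ᵥ (ρ *ᵥ v)).re := fun v hv =>
    (Complex.pos_iff.mp (hρ.dotProduct_mulVec_pos hv)).1
  have hne : ∀ v ∈ Metric.sphere (0 : ν → ℂ) 1, v ≠ 0 := fun v hv h => by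
    simp [h] at hv
  obtain ⟨v₀, hv₀, hmin⟩ := (isCompact_sphere (0 : ν → ℂ) 1).exists_isMinOn
    (NormedSpace.sphere_nonempty.mpr zero_le_one)
    (f := fun v => (star v ⬝ᵥ (X *ᵥ v)).re / (star v ⬝ᵥ (ρ *ᵥ v)).re)
    (ContinuousOn.div (by fun_prop) (by fun_prop) fun v hv => (hpos v (hne v hv)).ne')
  set m : ℝ := (star v₀ ⬝ᵥ (X *ᵥ v₀)).re / (star v₀ ⬝ᵥ (ρ *ᵥ v₀)).re with hm
  have hq : ∀ v, (star v ⬝ᵥ ((X - (m : ℂ) • ρ) *ᵥ v)).re =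
      (star v ⬝ᵥ (X *ᵥ v)).re - m * (star v ⬝ᵥ (ρ *ᵥ v)).re := fun v => by
    simp [Matrix.sub_mulVec, Matrix.smul_mulVec, dotProduct_sub]
  have hH : (X - (m : ℂ) • ρ).IsHermitian := hX.sub (isHermitian_ofReal_smul hρ.1 m)
  have hP : (X - (m : ℂ) • ρ).PosSemidef := by
    refine posSemidef_of_re_nonneg hH fun x => ?_
    rcases eq_or_ne x 0 with rfl | hx
    · simp
    have hu : ((‖x‖⁻¹ : ℝ) : ℂ) • x ∈ Metric.sphere (0 : ν → ℂ) 1 := by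
      simp [norm_smul, hx]
    have h : m ≤ _ := hmin hu
    rw [le_div_iff₀ (hpos _ (hne _ hu)), ← sub_nonneg, ← hq] at h
    simp only [star_smul, Matrix.mulVec_smul, smul_dotProduct, dotProduct_smul, smul_eq_mul,
      Complex.star_def, Complex.conj_ofReal, Complex.re_ofReal_mul] at h
    have hx' : 0 < ‖x‖⁻¹ := inv_pos.mpr (norm_pos_iff.mpr hx)
    exact nonneg_of_mul_nonneg_right (nonneg_of_mul_nonneg_right h hx') hx'
  refine ⟨m, hP, v₀, hne v₀ hv₀, ?_⟩
  rw [← hP.dotProduct_mulVec_zero_iff]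
  apply Complex.ext
  · rw [hq, hm, div_mul_cancel₀ _ (hpos v₀ (hne v₀ hv₀)).ne']
    simp
  · exact hH.im_star_dotProduct_mulVec_self v₀

end PosSemidef

section PerronFrobenius

variable {ι ν : Type*} [Fintype ι] [Fintype ν] [DecidableEq ν] (A : ι → Matrix ν ν ℂ)

open scoped Matrix.Norms.L2Operator in
theorem tendsto_smul_krausMap_pow_zero [Nonempty ν]
    (hA : ∀ μ ∈ spectrum ℂ (transfer A), ‖μ‖ ≤ 1) {r : ℝ} (hr₀ : 0 < r) (hr₁ : r < 1)
    (X : Matrix ν ν ℂ) :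
    Filter.Tendsto (fun n : ℕ => (((r : ℂ) • krausMap A) ^ n) X) Filter.atTop (nhds 0) := by
  have hr : (r : ℂ) ≠ 0 := by exact_mod_cast hr₀.ne'
  have hrad : spectralRadius ℂ ((r : ℂ) • transfer A) < 1 := by
    refine spectrum.spectralRadius_lt_of_forall_lt (r := 1) _ fun z hz => ?_
    obtain ⟨μ, hμ, rfl⟩ : ∃ μ ∈ spectrum ℂ (transfer A), (r : ℂ) * μ = z := by
      have := spectrum.unit_smul_eq_smul (transfer A) (Units.mk0 (r : ℂ) hr)
      rw [Units.smul_def, Units.val_mk0] at this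
      rw [this] at hz
      exact Set.mem_smul_set.mp hz
    have h₁ : ‖(r : ℂ) * μ‖ < 1 := by
      rw [norm_mul, Complex.norm_real, Real.norm_of_nonneg hr₀.le]
      nlinarith [hA μ hμ, norm_nonneg μ]
    exact h₁
  have hpow : ∀ n : ℕ, (((r : ℂ) • krausMap A) ^ n) X =
      (pairVec ν).symm (((r : ℂ) • transfer A) ^ n *ᵥ pairVec ν X) := fun n => by
    rw [LinearEquiv.eq_symm_apply]
    induction n with
    | zero => simp
    | succ n ih =>
      rw [pow_succ', pow_succ', Module.End.mul_apply, ← Matrix.mulVec_mulVec, ← ih,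
        LinearMap.smul_apply, map_smul, pairVec_krausMap, Matrix.smul_mulVec]
  simp_rw [hpow]
  have hcont : Continuous fun M : Matrix (ν × ν) (ν × ν) ℂ =>
      (pairVec ν).symm (M *ᵥ pairVec ν X) :=
    (LinearMap.continuous_of_finiteDimensional (pairVec ν).symm.toLinearMap).comp (by fun_prop)
  simpa [Function.comp_def] using
    (hcont.tendsto 0).comp (tendsto_pow_zero_of_spectralRadius_lt_one hrad)

theorem posSemidef_of_sub_smul_krausMap [Nonempty ν]
    (hA : ∀ μ ∈ spectrum ℂ (transfer A), ‖μ‖ ≤ 1) {r : ℝ} (hr₀ : 0 < r) (hr₁ : r < 1)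
    {R : Matrix ν ν ℂ} (hR : (R - (r : ℂ) • krausMap A R).PosSemidef) : R.PosSemidef := by
  set ψ := (r : ℂ) • krausMap A
  have hψ : ∀ n, ((ψ ^ n) (R - (r : ℂ) • krausMap A R)).PosSemidef := fun n => by
    induction n with
    | zero => simpa using hR
    | succ n ih =>
      rw [pow_succ', Module.End.mul_apply]
      exact posSemidef_ofReal_smul (krausMap_posSemidef A ih) hr₀.le
  have hsum : ∀ n, (R - (ψ ^ n) R).PosSemidef := fun n => by
    induction n with
    | zero => simpa using Matrix.PosSemidef.zero
    | succ n ih =>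
      have := ih.add (hψ n)
      rw [map_sub, sub_add_sub_cancel] at this
      rw [pow_succ]
      exact this
  have hlim : Filter.Tendsto (fun n => R - (ψ ^ n) R) Filter.atTop (nhds R) := by
    simpa using tendsto_const_nhds.sub (tendsto_smul_krausMap_pow_zero A hA hr₀ hr₁ R)
  exact isClosed_setOf_posSemidef.mem_of_tendsto hlim (Filter.Eventually.of_forall hsum)

theorem exists_sub_smul_krausMap_eq [Nonempty ν]
    (hA : ∀ μ ∈ spectrum ℂ (transfer A), ‖μ‖ ≤ 1) {r : ℝ} (hr₀ : 0 < r) (hr₁ : r < 1)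
    (Y : Matrix ν ν ℂ) : ∃ R, R - (r : ℂ) • krausMap A R = Y := by
  have hinj : Function.Injective
      ((1 - (r : ℂ) • krausMap A : Module.End ℂ (Matrix ν ν ℂ)) : Matrix ν ν ℂ → Matrix ν ν ℂ) := by
    rw [injective_iff_map_eq_zero]
    intro R hR
    have hR' : R - (r : ℂ) • krausMap A R = 0 := hR
    refine eq_zero_of_posSemidef_of_neg
      (posSemidef_of_sub_smul_krausMap A hA hr₀ hr₁ ?_)
      (posSemidef_of_sub_smul_krausMap A hA hr₀ hr₁ ?_)
    · rw [hR']
      exact Matrix.PosSemidef.zero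
    · rw [map_neg, smul_neg, ← neg_sub', hR', neg_zero]
      exact Matrix.PosSemidef.zero
  obtain ⟨R, hR⟩ := LinearMap.injective_iff_surjective.mp hinj Y
  exact ⟨R, hR⟩

open scoped Matrix.Norms.L2Operator in
/-- A positive map of spectral radius one that fixes a Hermitian matrix fixes a nonzero positive
semidefinite one. -/
theorem exists_posSemidef_krausMap_eq_self [Nonempty ν]
    (hA : ∀ μ ∈ spectrum ℂ (transfer A), ‖μ‖ ≤ 1) {X : Matrix ν ν ℂ} (hX : X.IsHermitian)
    (hX₀ : X ≠ 0) (hfix : krausMap A X = X) :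
    ∃ ρ : Matrix ν ν ℂ, ρ.PosSemidef ∧ ρ ≠ 0 ∧ krausMap A ρ = ρ := by
  by_cases hneg : (-X).PosSemidef
  · exact ⟨-X, hneg, neg_ne_zero.mpr hX₀, by rw [map_neg, hfix]⟩
  obtain ⟨v, hv⟩ : ∃ v, 0 < (star v ⬝ᵥ (X *ᵥ v)).re := by
    by_contra! h
    exact hneg (posSemidef_of_re_nonneg hX.neg fun x => by
      simpa [Matrix.neg_mulVec] using h x)
  obtain ⟨c, hc₀, hc⟩ : ∃ c : ℝ, 0 ≤ c ∧ ((c : ℂ) • (1 : Matrix ν ν ℂ) - X).PosSemidef := by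
    obtain ⟨m, hm, -⟩ := exists_posSemidef_sub_smul hX.neg (Matrix.PosDef.one (n := ν))
    refine ⟨max (-m) 0, le_max_right _ _, ?_⟩
    have h := hm.add (posSemidef_ofReal_smul (Matrix.PosSemidef.one (n := ν) (R := ℂ))
      (c := max (-m) 0 + m) (by linarith [le_max_left (-m) 0]))
    convert h using 1
    push_cast
    module
  let r : ℕ → ℝ := fun n => 1 - 1 / ((n : ℝ) + 2)
  have hr₀ : ∀ n, 0 < r n := fun n => by
    have : 1 / ((n : ℝ) + 2) < 1 := by
      rw [div_lt_one (by positivity)]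
      linarith [n.cast_nonneg (α := ℝ)]
    simp only [r]; linarith
  have hr₁ : ∀ n, r n < 1 := fun n => by
    have : 0 < 1 / ((n : ℝ) + 2) := by positivity
    simp only [r]; linarith
  have hrlim : Filter.Tendsto r Filter.atTop (nhds 1) := by
    have : Filter.Tendsto (fun n : ℕ => 1 / ((n : ℝ) + 2)) Filter.atTop (nhds 0) := by
      exact_mod_cast (Filter.tendsto_add_atTop_iff_nat 2).mpr
        (tendsto_one_div_atTop_nhds_zero_nat (𝕜 := ℝ))
    simpa [r] using (tendsto_const_nhds (x := (1 : ℝ))).sub this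
  choose R hR using fun n => exists_sub_smul_krausMap_eq A hA (hr₀ n) (hr₁ n)
    ((((1 - r n) * c : ℝ) : ℂ) • 1)
  have hRpos : ∀ n, (R n).PosSemidef := fun n => by
    refine posSemidef_of_sub_smul_krausMap A hA (hr₀ n) (hr₁ n) ?_
    rw [hR]
    exact posSemidef_ofReal_smul Matrix.PosSemidef.one
      (mul_nonneg (sub_nonneg.mpr (hr₁ n).le) hc₀)
  have hRX : ∀ n, (R n - X).PosSemidef := fun n => by
    refine posSemidef_of_sub_smul_krausMap A hA (hr₀ n) (hr₁ n) ?_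
    convert posSemidef_ofReal_smul hc (sub_nonneg.mpr (hr₁ n).le) using 1
    rw [map_sub, hfix, ← sub_eq_zero]
    calc _ = (R n - (r n : ℂ) • krausMap A (R n)) - (((1 - r n) * c : ℝ) : ℂ) • 1 := by
          push_cast
          module
      _ = 0 := by rw [hR, sub_self]
  let L : Matrix ν ν ℂ →ₗ[ℂ] ℂ :=
    { toFun := fun M => star v ⬝ᵥ (M *ᵥ v)
      map_add' := fun M N => by rw [Matrix.add_mulVec, dotProduct_add]
      map_smul' := fun a M => by simp [Matrix.smul_mulVec] }
  have hL : ∀ n, (L X).re ≤ ‖L.toContinuousLinearMap‖ * ‖R n‖ := fun n => by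
    have h := re_dotProduct_nonneg (hRX n) v
    rw [Matrix.sub_mulVec, dotProduct_sub, Complex.sub_re, sub_nonneg] at h
    exact h.trans ((Complex.re_le_norm _).trans (L.toContinuousLinearMap.le_opNorm (R n)))
  have hLpos : 0 < ‖L.toContinuousLinearMap‖ :=
    pos_of_mul_pos_left (hv.trans_le (hL 0)) (norm_nonneg _)
  set δ := (L X).re / ‖L.toContinuousLinearMap‖
  have hδ : 0 < δ := div_pos hv hLpos
  have hδR : ∀ n, δ ≤ ‖R n‖ := fun n => (div_le_iff₀' hLpos).mpr (hL n)
  have hRne : ∀ n, ‖R n‖ ≠ 0 := fun n => (hδ.trans_le (hδR n)).ne'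
  let τ : ℕ → Matrix ν ν ℂ := fun n => ((‖R n‖⁻¹ : ℝ) : ℂ) • R n
  have hτ : ∀ n, τ n ∈ Metric.sphere (0 : Matrix ν ν ℂ) 1 := fun n => by
    simp [τ, norm_smul, hRne n]
  obtain ⟨ρ, hρ, s, hs, hlim⟩ := (isCompact_sphere (0 : Matrix ν ν ℂ) 1).tendsto_subseq hτ
  refine ⟨ρ, ?_, ?_, ?_⟩
  · exact isClosed_setOf_posSemidef.mem_of_tendsto hlim (Filter.Eventually.of_forall fun n =>
      posSemidef_ofReal_smul (hRpos _) (inv_nonneg.mpr (norm_nonneg _)))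
  · rintro rfl
    simp at hρ
  · have hcont : Continuous (krausMap A) := LinearMap.continuous_of_finiteDimensional _
    have hτeq : ∀ n, τ n - (r n : ℂ) • krausMap A (τ n) =
        (((1 - r n) * (‖R n‖⁻¹ * c) : ℝ) : ℂ) • 1 := fun n => by
      simp only [τ, map_smul]
      rw [smul_comm (r n : ℂ), ← smul_sub, hR, smul_smul]
      push_cast
      congr 1
      ring
    have hlim₁ : Filter.Tendsto (fun n => τ (s n) - (r (s n) : ℂ) • krausMap A (τ (s n)))
        Filter.atTop (nhds (ρ - ((1 : ℝ) : ℂ) • krausMap A ρ)) :=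
      hlim.sub (((Complex.continuous_ofReal.tendsto 1).comp
        (hrlim.comp hs.tendsto_atTop)).smul ((hcont.tendsto ρ).comp hlim))
    have hlim₂ : Filter.Tendsto (fun n => τ (s n) - (r (s n) : ℂ) • krausMap A (τ (s n)))
        Filter.atTop (nhds 0) := by
      have hz : Filter.Tendsto (fun n => (1 - r n) * (‖R n‖⁻¹ * c)) Filter.atTop (nhds 0) := by
        have hb : Filter.Tendsto (fun n => (1 - r n) * (δ⁻¹ * c)) Filter.atTop (nhds 0) := by
          simpa using ((tendsto_const_nhds (x := (1 : ℝ))).sub hrlim).mul_const (δ⁻¹ * c)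
        refine squeeze_zero (fun n => ?_) (fun n => ?_) hb
        · exact mul_nonneg (sub_nonneg.mpr (hr₁ n).le)
            (mul_nonneg (inv_nonneg.mpr (norm_nonneg _)) hc₀)
        · exact mul_le_mul_of_nonneg_left
            (mul_le_mul_of_nonneg_right (inv_anti₀ hδ (hδR n)) hc₀)
            (sub_nonneg.mpr (hr₁ n).le)
      simp_rw [hτeq]
      simpa [Function.comp_def] using ((Complex.continuous_ofReal.tendsto 0).comp
        (hz.comp hs.tendsto_atTop)).smul_const (1 : Matrix ν ν ℂ)
    have h := tendsto_nhds_unique hlim₁ hlim₂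
    rw [Complex.ofReal_one, one_smul, sub_eq_zero] at h
    exact h.symm

end PerronFrobenius

section FixedPoints

variable {ι ν : Type*} [Fintype ι] [Fintype ν] (A : ι → Matrix ν ν ℂ)

theorem krausMap_pow_apply_of_sub_fixed {X : Matrix ν ν ℂ}
    (hX : krausMap A (krausMap A X - X) = krausMap A X - X) (n : ℕ) :
    (krausMap A ^ n) X = X + (n : ℂ) • (krausMap A X - X) := by
  induction n with
  | zero => simp
  | succ n ih =>
    rw [pow_succ', Module.End.mul_apply, ih, map_add, map_smul, hX]
    push_cast
    module

theorem posSemidef_krausMap_sub_self [Nonempty ν] {ρ : Matrix ν ν ℂ} (hρ : ρ.PosDef)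
    (hfix : krausMap A ρ = ρ) {X : Matrix ν ν ℂ} (hXh : X.IsHermitian)
    (hX : krausMap A (krausMap A X - X) = krausMap A X - X) :
    (krausMap A X - X).PosSemidef := by
  obtain ⟨m, hm, -⟩ := exists_posSemidef_sub_smul hXh hρ
  set Y := X - (m : ℂ) • ρ with hY
  have hYX : krausMap A Y - Y = krausMap A X - X := by
    rw [hY, map_sub, map_smul, hfix, sub_sub_sub_cancel_right]
  have hH : (krausMap A X - X).IsHermitian := by
    rw [Matrix.IsHermitian, Matrix.conjTranspose_sub, ← krausMap_conjTranspose, hXh.eq]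
  refine posSemidef_of_re_nonneg hH fun v => ?_
  by_contra! hneg
  set w := (star v ⬝ᵥ ((krausMap A X - X) *ᵥ v)).re with hw
  have hbound : ∀ n : ℕ, 0 ≤ (star v ⬝ᵥ (Y *ᵥ v)).re + n * w := fun n => by
    have h := re_dotProduct_nonneg (krausMap_pow_posSemidef A hm n) v
    rw [krausMap_pow_apply_of_sub_fixed A (by rw [hYX, hX]), hYX] at h
    simpa [Matrix.add_mulVec, Matrix.smul_mulVec, dotProduct_add, hw] using h
  obtain ⟨n, hn⟩ := exists_nat_gt ((star v ⬝ᵥ (Y *ᵥ v)).re / -w)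
  rw [div_lt_iff₀ (by linarith)] at hn
  linarith [hbound n]

theorem krausMap_eq_self_of_isHermitian [Nonempty ν] {ρ : Matrix ν ν ℂ} (hρ : ρ.PosDef)
    (hfix : krausMap A ρ = ρ) {X : Matrix ν ν ℂ} (hXh : X.IsHermitian)
    (hX : krausMap A (krausMap A X - X) = krausMap A X - X) : krausMap A X = X := by
  rw [← sub_eq_zero]
  refine eq_zero_of_posSemidef_of_neg (posSemidef_krausMap_sub_self A hρ hfix hXh hX) ?_
  have h := posSemidef_krausMap_sub_self A hρ hfix hXh.neg (by
    rw [map_neg, ← neg_sub', map_neg, hX])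
  rwa [map_neg, ← neg_sub'] at h

/-- A positive map with a positive definite fixed point has no Jordan block at eigenvalue one. -/
theorem krausMap_eq_self_of_sub_fixed [Nonempty ν] {ρ : Matrix ν ν ℂ} (hρ : ρ.PosDef)
    (hfix : krausMap A ρ = ρ) {X : Matrix ν ν ℂ}
    (hX : krausMap A (krausMap A X - X) = krausMap A X - X) : krausMap A X = X := by
  have hX' : krausMap A (krausMap A Xᴴ - Xᴴ) = krausMap A Xᴴ - Xᴴ := by
    rw [krausMap_conjTranspose, ← Matrix.conjTranspose_sub, krausMap_conjTranspose, hX]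
  have hadd : krausMap A (X + Xᴴ) = X + Xᴴ := by
    refine krausMap_eq_self_of_isHermitian A hρ hfix ?_ ?_
    · simp [Matrix.IsHermitian, add_comm]
    · rw [map_add, add_sub_add_comm, map_add, hX, hX']
  have hsub : krausMap A (Complex.I • (X - Xᴴ)) = Complex.I • (X - Xᴴ) := by
    refine krausMap_eq_self_of_isHermitian A hρ hfix ?_ ?_
    · simp [Matrix.IsHermitian, ← smul_neg]
    · rw [map_smul, ← smul_sub, map_smul, map_sub (krausMap A) X, sub_sub_sub_comm, map_sub, hX,
        hX']
  have hsub' : krausMap A (X - Xᴴ) = X - Xᴴ := by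
    rw [map_smul] at hsub
    exact smul_right_injective _ Complex.I_ne_zero hsub
  have h2 : X = (2⁻¹ : ℂ) • ((X + Xᴴ) + (X - Xᴴ)) := by module
  rw [h2, map_smul, map_add, hadd, hsub']

theorem mulVec_conjTranspose_mulVec_eq_zero {ρ : Matrix ν ν ℂ} (hρ : ρ.PosSemidef)
    (hfix : krausMap A ρ = ρ) {v : ν → ℂ} (hv : ρ *ᵥ v = 0) (i : ι) :
    ρ *ᵥ ((A i)ᴴ *ᵥ v) = 0 := by
  have hterm : ∀ j, star v ⬝ᵥ ((A j * ρ * (A j)ᴴ) *ᵥ v) =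
      star ((A j)ᴴ *ᵥ v) ⬝ᵥ (ρ *ᵥ ((A j)ᴴ *ᵥ v)) := fun j => by
    rw [Matrix.star_mulVec, Matrix.conjTranspose_conjTranspose, ← Matrix.dotProduct_mulVec,
      Matrix.mulVec_mulVec, Matrix.mulVec_mulVec, Matrix.mul_assoc]
  have hsum : ∑ j, star ((A j)ᴴ *ᵥ v) ⬝ᵥ (ρ *ᵥ ((A j)ᴴ *ᵥ v)) = 0 := by
    have h : star v ⬝ᵥ (krausMap A ρ *ᵥ v) = 0 := by rw [hfix, hv, dotProduct_zero]
    rw [krausMap_apply, Matrix.sum_mulVec, dotProduct_sum] at h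
    simpa only [hterm] using h
  rw [Finset.sum_eq_zero_iff_of_nonneg fun j _ => hρ.dotProduct_mulVec_nonneg _] at hsum
  exact (hρ.dotProduct_mulVec_zero_iff _).mp (hsum i (Finset.mem_univ i))

end FixedPoints

theorem exists_orthogonalProjector {ν : Type*} [Fintype ν] [DecidableEq ν]
    (K : Submodule ℂ (ν → ℂ)) :
    ∃ Q : Matrix ν ν ℂ, Qᴴ = Q ∧ (∀ v, Q *ᵥ v ∈ K) ∧ ∀ v ∈ K, Q *ᵥ v = v := by
  let K' : Submodule ℂ (EuclideanSpace ℂ ν) :=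
    K.comap (WithLp.linearEquiv 2 ℂ (ν → ℂ)).toLinearMap
  let T : EuclideanSpace ℂ ν →ₗ[ℂ] EuclideanSpace ℂ ν := K'.starProjection.toLinearMap
  let Q : Matrix ν ν ℂ := Matrix.toEuclideanLin.symm T
  have hQ : ∀ v : ν → ℂ, Q *ᵥ v = WithLp.ofLp (T (WithLp.toLp 2 v)) := fun v => by
    rw [← Matrix.toEuclideanLin.apply_symm_apply T]
    rfl
  refine ⟨Q, ?_, fun v => ?_, fun v hv => ?_⟩
  · apply Matrix.toEuclideanLin.injective
    rw [Matrix.toEuclideanLin_conjTranspose_eq_adjoint]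
    simp only [Q, LinearEquiv.apply_symm_apply]
    have hT : T.IsSymmetric := K'.starProjection_isSymmetric
    exact (LinearMap.isSymmetric_iff_isSelfAdjoint T).mp hT
  · rw [hQ]
    exact K'.starProjection_apply_mem (WithLp.toLp 2 v)
  · rw [hQ]
    have hmem : WithLp.toLp 2 v ∈ K' := hv
    exact congrArg WithLp.ofLp (Submodule.starProjection_eq_self_iff.mpr hmem)

theorem GradedIrreducible.eq_bot_or_eq_top {ι ν : Type*} [Fintype ν] [DecidableEq ν]
    {A : ι → Matrix ν ν ℂ} {Z : Matrix ν ν ℂ} (hirr : GradedIrreducible A Z) (hZ : Zᴴ = Z)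
    (K : Submodule ℂ (ν → ℂ)) (hKA : ∀ i, ∀ v ∈ K, (A i)ᴴ *ᵥ v ∈ K)
    (hKZ : ∀ v ∈ K, Z *ᵥ v ∈ K) : K = ⊥ ∨ K = ⊤ := by
  obtain ⟨Q, hQh, hQK, hQ⟩ := exists_orthogonalProjector K
  have habs : ∀ M : Matrix ν ν ℂ, (∀ v ∈ K, M *ᵥ v ∈ K) → Q * M * Q = M * Q := fun M hM => by
    refine Matrix.ext_of_mulVec_single fun j => ?_
    rw [← Matrix.mulVec_mulVec, ← Matrix.mulVec_mulVec, ← Matrix.mulVec_mulVec]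
    exact hQ _ (hM _ (hQK _))
  have hQQ : Q * Q = Q := by simpa using habs 1 (by simp)
  have hQZ : Q * Z = Z * Q := by
    have h := habs Z hKZ
    have h' := congrArg Matrix.conjTranspose h
    simp only [Matrix.conjTranspose_mul, hQh, hZ] at h'
    rw [← h', ← Matrix.mul_assoc, h]
  by_contra! hK
  refine hirr ⟨1 - Q, ?_, ?_, ?_, ?_, ?_, fun i => ?_⟩
  · simp [Matrix.mul_sub, Matrix.sub_mul, hQQ]
  · simp [hQh]
  · intro h
    refine hK.2 (eq_top_iff.mpr fun v _ => ?_)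
    have := hQK v
    rwa [← sub_eq_zero.mp h, Matrix.one_mulVec] at this
  · intro h
    have hQ₀ : Q = 0 := by simpa using h
    refine hK.1 (eq_bot_iff.mpr fun v hv => ?_)
    rw [Submodule.mem_bot, ← hQ v hv, hQ₀, Matrix.zero_mulVec]
  · simp [Matrix.mul_sub, Matrix.sub_mul, hQZ]
  · have h := congrArg Matrix.conjTranspose (habs _ (hKA i))
    simp only [Matrix.conjTranspose_mul, hQh, Matrix.conjTranspose_conjTranspose] at h
    simp only [Matrix.mul_sub, Matrix.sub_mul, Matrix.mul_one, Matrix.one_mul, ← h]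
    simp

theorem sgn_mul_self (x : ZMod 2) : sgn x * sgn x = 1 := by
  rw [sgn, ← mul_pow]
  norm_num

theorem star_sgn (x : ZMod 2) : star (sgn x) = sgn x := by
  rw [sgn, star_pow, star_neg, star_one]

section Graded

variable {ι ν : Type*} [Fintype ν] {p : ι → ZMod 2}
  {A : ι → Matrix ν ν ℂ} {Z : Matrix ν ν ℂ}

theorem EvenTensor.mul_parity (hA : EvenTensor p A Z) (i : ι) :
    A i * Z = sgn (p i) • (Z * A i) := by
  rw [hA i, smul_smul, sgn_mul_self, one_smul]

theorem EvenTensor.parity_mul_conjTranspose (hA : EvenTensor p A Z) (hZ : Zᴴ = Z) (i : ι) :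
    Z * (A i)ᴴ = sgn (p i) • ((A i)ᴴ * Z) := by
  have h := congrArg Matrix.conjTranspose (hA.mul_parity i)
  rwa [Matrix.conjTranspose_mul, Matrix.conjTranspose_smul, Matrix.conjTranspose_mul, hZ,
    star_sgn] at h

variable [Fintype ι]

theorem EvenTensor.krausMap_parity_conj (hA : EvenTensor p A Z) (hZ : Zᴴ = Z)
    (X : Matrix ν ν ℂ) : krausMap A (Z * X * Z) = Z * krausMap A X * Z := by
  rw [krausMap_apply, krausMap_apply, Matrix.mul_sum, Matrix.sum_mul]
  refine Finset.sum_congr rfl fun i _ => ?_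
  calc A i * (Z * X * Z) * (A i)ᴴ = (A i * Z) * X * (Z * (A i)ᴴ) := by
        simp only [Matrix.mul_assoc]
    _ = Z * (A i * X * (A i)ᴴ) * Z := by
        rw [hA.mul_parity, hA.parity_mul_conjTranspose hZ]
        simp only [Matrix.smul_mul, Matrix.mul_smul, smul_smul, sgn_mul_self, one_smul,
          Matrix.mul_assoc]

/-- A Hermitian fixed point that spans the eigenspace of eigenvalue one over the Hermitian
matrices spans it over all matrices. -/
theorem krausMap_eigenspace_le_span {ρ : Matrix ν ν ℂ}
    (h : ∀ X : Matrix ν ν ℂ, X.IsHermitian → krausMap A X = X → ∃ c : ℂ, X = c • ρ) :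
    (krausMap A).eigenspace 1 ≤ Submodule.span ℂ {ρ} := by
  intro X hX
  have hX : krausMap A X = X := by simpa [Module.End.mem_eigenspace_iff] using hX
  obtain ⟨c, hc⟩ := h (X + Xᴴ) (by simp [Matrix.IsHermitian, add_comm])
    (by rw [map_add, krausMap_conjTranspose, hX])
  obtain ⟨e, he⟩ := h (Complex.I • (X - Xᴴ)) (by simp [Matrix.IsHermitian, ← smul_neg])
    (by rw [map_smul, map_sub, krausMap_conjTranspose, hX])
  refine Submodule.mem_span_singleton.mpr ⟨2⁻¹ * (c - Complex.I * e), ?_⟩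
  have h2 : X = (2⁻¹ : ℂ) • ((X + Xᴴ) - Complex.I • Complex.I • (X - Xᴴ)) := by
    rw [smul_smul, Complex.I_mul_I]
    module
  rw [h2, hc, he]
  module

variable [DecidableEq ν]

theorem GradedNormal.nonempty {m : ℕ} (h : GradedNormal A Z m) (hm : m ≠ 0) : Nonempty ν := by
  by_contra hν
  rw [not_nonempty_iff] at hν
  apply hm
  rw [← h.2.1, Matrix.charpoly, Matrix.det_isEmpty]
  exact Polynomial.rootMultiplicity_eq_zero (by simp)

theorem GradedNormal.norm_le_one {m : ℕ} (h : GradedNormal A Z m) :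
    ∀ μ ∈ spectrum ℂ (transfer A), ‖μ‖ ≤ 1 := fun μ hμ => by
  rcases eq_or_ne μ 1 with rfl | hne
  · simp
  · exact (h.2.2 μ hμ hne).le

theorem EvenTensor.exists_posDef_krausMap_eq_self (hA : EvenTensor p A Z) (hZ : Zᴴ = Z)
    (hZZ : Z * Z = 1) {m : ℕ} (h : GradedNormal A Z m) (hm : m ≠ 0) :
    ∃ ρ : Matrix ν ν ℂ, ρ.PosDef ∧ krausMap A ρ = ρ := by
  have := h.nonempty hm
  have hev : (krausMap A).HasEigenvalue 1 := by
    rw [hasEigenvalue_krausMap_iff, Matrix.mem_spectrum_iff_isRoot_charpoly]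
    by_contra hroot
    exact hm (h.2.1.symm.trans (Polynomial.rootMultiplicity_eq_zero hroot))
  obtain ⟨X, hXh, hXfix, hX⟩ : ∃ X : Matrix ν ν ℂ, X.IsHermitian ∧ krausMap A X = X ∧ X ≠ 0 := by
    by_contra! hno
    have hle := krausMap_eigenspace_le_span (A := A) (ρ := 0) fun X h₁ h₂ =>
      ⟨0, by rw [hno X h₁ h₂, smul_zero]⟩
    rw [Submodule.span_zero_singleton, le_bot_iff] at hle
    exact hev hle
  obtain ⟨ρ₀, hρ₀, hρ₀ne, hρ₀fix⟩ := exists_posSemidef_krausMap_eq_self A h.norm_le_one hXh hX hXfix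
  have hconj : (Z * ρ₀ * Z).PosSemidef := by
    have := hρ₀.mul_mul_conjTranspose_same Z
    rwa [hZ] at this
  set ρ := ρ₀ + Z * ρ₀ * Z with hρdef
  have hρ : ρ.PosSemidef := hρ₀.add hconj
  have hfix : krausMap A ρ = ρ := by
    rw [hρdef, map_add, hA.krausMap_parity_conj hZ, hρ₀fix]
  have hρZ : ρ * Z = Z * ρ := by
    simp only [hρdef, Matrix.add_mul, Matrix.mul_add, Matrix.mul_assoc, hZZ, Matrix.mul_one]
    rw [← Matrix.mul_assoc Z Z, hZZ, Matrix.one_mul, add_comm]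
  have hρne : ρ ≠ 0 := fun h₀ => hρ₀ne <| eq_zero_of_posSemidef_of_neg hρ₀ <| by
    rwa [neg_eq_of_add_eq_zero_right h₀]
  have hker := h.1.eq_bot_or_eq_top hZ (LinearMap.ker (Matrix.mulVecLin ρ))
    (fun i v hv => mulVec_conjTranspose_mulVec_eq_zero A hρ hfix hv i)
    (fun v hv => by
      have hv' : ρ *ᵥ v = 0 := hv
      change ρ *ᵥ (Z *ᵥ v) = 0
      rw [Matrix.mulVec_mulVec, hρZ, ← Matrix.mulVec_mulVec, hv', Matrix.mulVec_zero])
  have hbot : LinearMap.ker (Matrix.mulVecLin ρ) = ⊥ := hker.resolve_right fun htop => hρne <| by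
    refine Matrix.ext_of_mulVec_single fun j => ?_
    rw [Matrix.zero_mulVec]
    exact LinearMap.mem_ker.mp (htop ▸ Submodule.mem_top)
  refine ⟨ρ, Matrix.PosDef.of_dotProduct_mulVec_pos hρ.1 fun {x} hx => ?_, hfix⟩
  refine lt_of_le_of_ne (hρ.dotProduct_mulVec_nonneg x) fun h₀ => hx ?_
  have : x ∈ LinearMap.ker (Matrix.mulVecLin ρ) :=
    (hρ.dotProduct_mulVec_zero_iff x).mp h₀.symm
  rwa [hbot] at this

theorem GradedNormal.exists_isHermitian_fixed (h : GradedNormal A Z 2) {ρ : Matrix ν ν ℂ}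
    (hρ : ρ.PosDef) (hfix : krausMap A ρ = ρ) :
    ∃ X : Matrix ν ν ℂ, X.IsHermitian ∧ krausMap A X = X ∧ ∀ c : ℂ, X ≠ c • ρ := by
  have := h.nonempty two_ne_zero
  by_contra! hno
  have hle := krausMap_eigenspace_le_span hno
  have hmax : (krausMap A).maxGenEigenspace 1 = (krausMap A).eigenspace 1 := by
    refine le_antisymm (fun X hX => ?_) ?_
    · rw [Module.End.mem_maxGenEigenspace] at hX
      obtain ⟨k, hk⟩ := hX
      have hfixed : ∀ Y : Matrix ν ν ℂ, ((krausMap A - (1 : ℂ) • 1) ^ k) Y = 0 →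
          krausMap A Y = Y := by
        intro Y hY
        clear hk
        induction k generalizing Y with
        | zero => rw [show Y = 0 by simpa using hY, map_zero]
        | succ k ih =>
          rw [pow_succ, Module.End.mul_apply] at hY
          have h₁ := ih _ hY
          refine krausMap_eq_self_of_sub_fixed A hρ hfix ?_
          simpa using h₁
      rw [Module.End.mem_eigenspace_iff, one_smul, hfixed X hk]
    · exact ((krausMap A).genEigenspace 1).monotone le_top
  have hdim := LinearMap.finrank_maxGenEigenspace_eq (krausMap A) 1
  rw [charpoly_krausMap, h.2.1, hmax] at hdim
  have h₁ := (Submodule.finrank_mono hle).trans (finrank_span_le_card _)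
  rw [hdim] at h₁
  simp at h₁

/-- A graded normal degenerate tensor commutes with an odd involution. -/
theorem EvenTensor.exists_odd_involution (hA : EvenTensor p A Z) (hZ : Zᴴ = Z)
    (hZZ : Z * Z = 1) (h : GradedNormal A Z 2) :
    ∃ X : Matrix ν ν ℂ, X * X = 1 ∧ X * Z = -(Z * X) ∧ ∀ i, A i * X = X * A i := by
  have := h.nonempty two_ne_zero
  obtain ⟨ρ, hρ, hfix⟩ := hA.exists_posDef_krausMap_eq_self hZ hZZ h two_ne_zero
  obtain ⟨F, hFh, hFfix, hF⟩ := h.exists_isHermitian_fixed hρ hfix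
  obtain ⟨m, hσ, v, hv, hσv⟩ := exists_posSemidef_sub_smul hFh hρ
  set σ := F - (m : ℂ) • ρ with hσdef
  have hσfix : krausMap A σ = σ := by rw [hσdef, map_sub, map_smul, hFfix, hfix]
  have hZv : ∀ w, Z *ᵥ (Z *ᵥ w) = w := fun w => by
    rw [Matrix.mulVec_mulVec, hZZ, Matrix.one_mulVec]
  have hZB : ∀ i w, (A i)ᴴ *ᵥ (Z *ᵥ w) = sgn (p i) • (Z *ᵥ ((A i)ᴴ *ᵥ w)) := fun i w => by
    rw [Matrix.mulVec_mulVec, Matrix.mulVec_mulVec, hA.parity_mul_conjTranspose hZ,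
      Matrix.smul_mulVec, smul_smul, sgn_mul_self, one_smul]
  let K : Submodule ℂ (ν → ℂ) := LinearMap.ker (Matrix.mulVecLin σ)
  let K' : Submodule ℂ (ν → ℂ) := K.comap (Matrix.mulVecLin Z)
  have hK' : ∀ w, w ∈ K' ↔ Z *ᵥ w ∈ K := fun w => Iff.rfl
  have hKB : ∀ i, ∀ w ∈ K, (A i)ᴴ *ᵥ w ∈ K := fun i w hw =>
    mulVec_conjTranspose_mulVec_eq_zero A hσ hσfix hw i
  have hK'B : ∀ i, ∀ w ∈ K', (A i)ᴴ *ᵥ w ∈ K' := fun i w hw => by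
    have h₁ := hKB i _ ((hK' w).mp hw)
    rw [hZB] at h₁
    have h₂ := K.smul_mem (sgn (p i)) h₁
    rwa [smul_smul, sgn_mul_self, one_smul] at h₂
  have hKZ : ∀ w ∈ K, Z *ᵥ w ∈ K' := fun w hw => by rwa [hK', hZv]
  have hKbot : K ≠ ⊥ := fun h₀ => hv <| by
    have : v ∈ K := hσv
    rwa [h₀] at this
  have hKtop : K ≠ ⊤ := fun h₀ => hF m <| by
    rw [← sub_eq_zero, ← hσdef]
    refine Matrix.ext_of_mulVec_single fun j => ?_
    rw [Matrix.zero_mulVec]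
    exact LinearMap.mem_ker.mp (show _ ∈ K from h₀ ▸ Submodule.mem_top)
  have hinf : K ⊓ K' = ⊥ := by
    refine (h.1.eq_bot_or_eq_top hZ (K ⊓ K') (fun i w hw => ⟨hKB i w hw.1, hK'B i w hw.2⟩)
      (fun w hw => ⟨hw.2, hKZ w hw.1⟩)).resolve_right fun h₀ => hKtop ?_
    exact top_le_iff.mp (h₀ ▸ inf_le_left)
  have hsup : K ⊔ K' = ⊤ := by
    refine (h.1.eq_bot_or_eq_top hZ (K ⊔ K') (fun i w hw => ?_) (fun w hw => ?_)).resolve_left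
      fun h₀ => hKbot (le_bot_iff.mp (h₀ ▸ le_sup_left))
    · obtain ⟨a, ha, b, hb, rfl⟩ := Submodule.mem_sup.mp hw
      rw [Matrix.mulVec_add]
      exact Submodule.add_mem_sup (hKB i a ha) (hK'B i b hb)
    · obtain ⟨a, ha, b, hb, rfl⟩ := Submodule.mem_sup.mp hw
      rw [Matrix.mulVec_add, add_comm]
      exact Submodule.add_mem_sup hb (hKZ a ha)
  have hcompl : IsCompl K K' := ⟨disjoint_iff.mpr hinf, codisjoint_iff.mpr hsup⟩
  have hext : ∀ M N : Matrix ν ν ℂ, (∀ w ∈ K, M *ᵥ w = N *ᵥ w) →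
      (∀ w ∈ K', M *ᵥ w = N *ᵥ w) → M = N := fun M N h₁ h₂ => by
    apply Matrix.toLin'.injective
    exact LinearMap.ext_on_codisjoint hcompl.codisjoint h₁ h₂
  let G : Matrix ν ν ℂ := LinearMap.toMatrix' (2 • K.projection K' hcompl - LinearMap.id)
  have hG : ∀ w, G *ᵥ w = 2 • K.projection K' hcompl w - w := fun w => by
    rw [← Matrix.toLin'_apply, Matrix.toLin'_toMatrix']
    rfl
  have hG₁ : ∀ w ∈ K, G *ᵥ w = w := fun w hw => by
    rw [hG, Submodule.projection_apply_left hcompl ⟨w, hw⟩]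
    module
  have hG₂ : ∀ w ∈ K', G *ᵥ w = -w := fun w hw => by
    rw [hG, Submodule.projection_apply_right hcompl ⟨w, hw⟩]
    module
  have hGG : G * G = 1 := by
    refine hext _ _ (fun w hw => ?_) (fun w hw => ?_)
    · rw [← Matrix.mulVec_mulVec, hG₁ w hw, hG₁ w hw, Matrix.one_mulVec]
    · rw [← Matrix.mulVec_mulVec, hG₂ w hw, Matrix.mulVec_neg, hG₂ w hw, neg_neg,
        Matrix.one_mulVec]
  have hGZ : G * Z = -(Z * G) := by
    refine hext _ _ (fun w hw => ?_) (fun w hw => ?_)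
    · rw [Matrix.neg_mulVec, ← Matrix.mulVec_mulVec, ← Matrix.mulVec_mulVec, hG₁ w hw,
        hG₂ _ (hKZ w hw)]
    · rw [Matrix.neg_mulVec, ← Matrix.mulVec_mulVec, ← Matrix.mulVec_mulVec, hG₂ w hw,
        hG₁ _ ((hK' w).mp hw), Matrix.mulVec_neg, neg_neg]
  have hGB : ∀ i, G * (A i)ᴴ = (A i)ᴴ * G := fun i => by
    refine hext _ _ (fun w hw => ?_) (fun w hw => ?_)
    · rw [← Matrix.mulVec_mulVec, ← Matrix.mulVec_mulVec, hG₁ w hw, hG₁ _ (hKB i w hw)]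
    · rw [← Matrix.mulVec_mulVec, ← Matrix.mulVec_mulVec, hG₂ w hw, hG₂ _ (hK'B i w hw),
        Matrix.mulVec_neg]
  refine ⟨Gᴴ, ?_, ?_, fun i => ?_⟩
  · rw [← Matrix.conjTranspose_mul, hGG, Matrix.conjTranspose_one]
  · have h₁ := congrArg Matrix.conjTranspose hGZ
    rw [Matrix.conjTranspose_neg, Matrix.conjTranspose_mul, Matrix.conjTranspose_mul, hZ] at h₁
    rw [h₁, neg_neg]
  · have h₁ := congrArg Matrix.conjTranspose (hGB i)
    rwa [Matrix.conjTranspose_mul, Matrix.conjTranspose_mul, Matrix.conjTranspose_conjTranspose]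
      at h₁

end Graded

theorem eq_zero_of_eq_neg {m n : Type*} {M : Matrix m n ℂ} (h : M = -M) : M = 0 :=
  Matrix.ext fun i j => self_eq_neg.mp (congrFun (congrFun h i) j)

section Blocks

variable {m n : Type*} [DecidableEq m] [DecidableEq n]

/-- The parity matrix `diag(I, -I)`. -/
local notation "ζ" => Matrix.fromBlocks (1 : Matrix m m ℂ) 0 0 (-(1 : Matrix n n ℂ))

theorem conjTranspose_blockParity : (ζ)ᴴ = ζ := by
  simp [Matrix.fromBlocks_conjTranspose]

variable [Fintype m] [Fintype n]

theorem blockParity_mul_self : ζ * ζ = 1 := by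
  simp [Matrix.fromBlocks_multiply, Matrix.fromBlocks_one]

theorem blocks_eq_zero_of_comm_blockParity {a : Matrix m m ℂ} {b : Matrix m n ℂ}
    {c : Matrix n m ℂ} {e : Matrix n n ℂ}
    (h : ζ * Matrix.fromBlocks a b c e = Matrix.fromBlocks a b c e * ζ) : b = 0 ∧ c = 0 := by
  simp only [Matrix.fromBlocks_multiply, Matrix.fromBlocks_inj, Matrix.one_mul, Matrix.mul_one,
    Matrix.zero_mul, Matrix.mul_zero, add_zero, zero_add, Matrix.neg_mul, Matrix.mul_neg] at h
  exact ⟨eq_zero_of_eq_neg h.2.1, eq_zero_of_eq_neg h.2.2.1.symm⟩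

theorem blocks_eq_zero_of_anticomm_blockParity {a : Matrix m m ℂ} {b : Matrix m n ℂ}
    {c : Matrix n m ℂ} {e : Matrix n n ℂ}
    (h : ζ * Matrix.fromBlocks a b c e = -(Matrix.fromBlocks a b c e * ζ)) : a = 0 ∧ e = 0 := by
  simp only [Matrix.fromBlocks_multiply, Matrix.fromBlocks_neg, Matrix.fromBlocks_inj,
    Matrix.one_mul, Matrix.mul_one, Matrix.zero_mul, Matrix.mul_zero, add_zero, zero_add,
    Matrix.neg_mul, Matrix.mul_neg, neg_neg] at h
  exact ⟨eq_zero_of_eq_neg h.1, eq_zero_of_eq_neg h.2.2.2.symm⟩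

/-- An odd involution is off-diagonal, with mutually inverse blocks. -/
theorem exists_fromBlocks_of_odd_involution {X : Matrix (m ⊕ n) (m ⊕ n) ℂ} (hXX : X * X = 1)
    (hX : X * ζ = -(ζ * X)) :
    ∃ (P : Matrix m n ℂ) (Q : Matrix n m ℂ),
      X = Matrix.fromBlocks 0 P Q 0 ∧ P * Q = 1 ∧ Q * P = 1 := by
  have hX' : ζ * X = -(X * ζ) := by rw [hX, neg_neg]
  rw [← Matrix.fromBlocks_toBlocks X] at hX' hXX
  obtain ⟨h₁, h₂⟩ := blocks_eq_zero_of_anticomm_blockParity hX'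
  rw [h₁, h₂, Matrix.fromBlocks_multiply, ← Matrix.fromBlocks_one, Matrix.fromBlocks_inj] at hXX
  refine ⟨X.toBlocks₁₂, X.toBlocks₂₁, ?_, by simpa using hXX.1, by simpa using hXX.2.2.2⟩
  conv_lhs => rw [← Matrix.fromBlocks_toBlocks X, h₁, h₂]

/-- An even block matrix that commutes with an odd involution is conjugate to `diag(a, a)`. -/
theorem conj_fromBlocks_of_even {P : Matrix m n ℂ} {Q : Matrix n m ℂ} (hPQ : P * Q = 1)
    {M : Matrix (m ⊕ n) (m ⊕ n) ℂ} (hM : ζ * M = M * ζ)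
    (hMX : M * Matrix.fromBlocks 0 P Q 0 = Matrix.fromBlocks 0 P Q 0 * M) :
    Matrix.fromBlocks (1 : Matrix m m ℂ) 0 0 P * M *
        Matrix.fromBlocks (1 : Matrix m m ℂ) 0 0 Q =
      Matrix.fromBlocks M.toBlocks₁₁ 0 0 M.toBlocks₁₁ := by
  rw [← Matrix.fromBlocks_toBlocks M] at hM hMX
  obtain ⟨h₁, h₂⟩ := blocks_eq_zero_of_comm_blockParity hM
  simp only [h₁, h₂, Matrix.fromBlocks_multiply, Matrix.fromBlocks_inj, Matrix.zero_mul,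
    Matrix.mul_zero, add_zero, zero_add] at hMX
  conv_lhs => rw [← Matrix.fromBlocks_toBlocks M, h₁, h₂]
  simp [Matrix.fromBlocks_multiply, ← hMX.2.1, Matrix.mul_assoc, hPQ]

/-- An odd block matrix that commutes with an odd involution is conjugate to an off-diagonal
matrix with equal blocks. -/
theorem conj_fromBlocks_of_odd {P : Matrix m n ℂ} {Q : Matrix n m ℂ}
    {M : Matrix (m ⊕ n) (m ⊕ n) ℂ} (hM : ζ * M = -(M * ζ))
    (hMX : M * Matrix.fromBlocks 0 P Q 0 = Matrix.fromBlocks 0 P Q 0 * M) :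
    Matrix.fromBlocks (1 : Matrix m m ℂ) 0 0 P * M *
        Matrix.fromBlocks (1 : Matrix m m ℂ) 0 0 Q =
      Matrix.fromBlocks 0 (M.toBlocks₁₂ * Q) (M.toBlocks₁₂ * Q) 0 := by
  rw [← Matrix.fromBlocks_toBlocks M] at hM hMX
  obtain ⟨h₁, h₂⟩ := blocks_eq_zero_of_anticomm_blockParity hM
  simp only [h₁, h₂, Matrix.fromBlocks_multiply, Matrix.fromBlocks_inj, Matrix.zero_mul,
    Matrix.mul_zero, add_zero, zero_add] at hMX
  conv_lhs => rw [← Matrix.fromBlocks_toBlocks M, h₁, h₂]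
  simp [Matrix.fromBlocks_multiply, hMX.1]

/-- A graded irreducible tensor on a space with nonzero even and odd parts has a nonzero
odd matrix. -/
theorem GradedIrreducible.exists_odd_ne_zero [Nonempty m] [Nonempty n] {ι : Type*}
    {p : ι → ZMod 2} {A : ι → Matrix (m ⊕ n) (m ⊕ n) ℂ} (h : GradedIrreducible A ζ)
    (hA : EvenTensor p A ζ) : ∃ i, p i = 1 ∧ A i ≠ 0 := by
  by_contra! hno
  refine h ⟨Matrix.fromBlocks 1 0 0 0, ?_, ?_, ?_, ?_, ?_, fun i => ?_⟩
  · simp [Matrix.fromBlocks_multiply]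
  · simp [Matrix.fromBlocks_conjTranspose]
  · rw [← Matrix.fromBlocks_zero, Ne, Matrix.fromBlocks_inj]
    simp
  · rw [← Matrix.fromBlocks_one, Ne, Matrix.fromBlocks_inj]
    simp
  · simp [Matrix.fromBlocks_multiply]
  · have hcomm : ζ * A i = A i * ζ := by
      rcases (by decide : ∀ x : ZMod 2, x = 0 ∨ x = 1) (p i) with hi | hi
      · simpa [hi, sgn] using hA i
      · simp [hno i hi]
    rw [← Matrix.fromBlocks_toBlocks (A i)] at hcomm ⊢
    obtain ⟨h₁, h₂⟩ := blocks_eq_zero_of_comm_blockParity hcomm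
    simp [h₁, h₂, Matrix.fromBlocks_multiply]

end Blocks

/-- A graded normal tensor has a nonzero even matrix. -/
theorem EvenTensor.exists_even_ne_zero {ι ν : Type*} [Fintype ι] [Fintype ν] [DecidableEq ν]
    {p : ι → ZMod 2} {A : ι → Matrix ν ν ℂ} {Z : Matrix ν ν ℂ} (hA : EvenTensor p A Z)
    (hZ : Zᴴ = Z) (hZZ : Z * Z = 1) {m : ℕ} (h : GradedNormal A Z m) (hm : m ≠ 0) :
    ∃ j, p j = 0 ∧ A j ≠ 0 := by
  by_contra! hno
  have := h.nonempty hm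
  obtain ⟨ρ, hρ, hfix⟩ := hA.exists_posDef_krausMap_eq_self hZ hZZ h hm
  have hanti : ∀ i, A i * Z = -(Z * A i) := fun i => by
    rcases (by decide : ∀ x : ZMod 2, x = 0 ∨ x = 1) (p i) with hi | hi
    · simp [hno i hi]
    · simpa [hi, sgn, ZMod.val_one] using hA.mul_parity i
  have hρZ : krausMap A (Z * ρ) = (-1 : ℂ) • (Z * ρ) := by
    conv_rhs => rw [← hfix]
    rw [krausMap_apply, krausMap_apply, Matrix.mul_sum, Finset.smul_sum]
    refine Finset.sum_congr rfl fun i _ => ?_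
    rw [← Matrix.mul_assoc, hanti]
    simp [Matrix.mul_assoc]
  have hne : Z * ρ ≠ 0 := fun h₀ => by
    have hρ₀ : ρ = 0 := by rw [← Matrix.one_mul ρ, ← hZZ, Matrix.mul_assoc, h₀, Matrix.mul_zero]
    exact hρ.isUnit.ne_zero hρ₀
  have hspec := (hasEigenvalue_krausMap_iff A (-1)).mp
    (Module.End.hasEigenvalue_of_hasEigenvector ⟨Module.End.mem_eigenspace_iff.mpr hρZ, hne⟩)
  have hlt := h.2.2 _ hspec (by norm_num)
  simp at hlt

theorem reindex_sumToBP_even {De : ℕ} (a : Matrix (Fin De) (Fin De) ℂ) :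
    Matrix.reindex (sumToBP (rfl : De = De)) (sumToBP rfl) (Matrix.fromBlocks a 0 0 a) =
      (pauliX ^ 0) ⊗ₖ a := by
  ext ⟨x, k⟩ ⟨y, l⟩
  cases x <;> cases y <;> simp [sumToBP, Matrix.kroneckerMap_apply, Matrix.fromBlocks]

theorem reindex_sumToBP_odd {De : ℕ} (a : Matrix (Fin De) (Fin De) ℂ) :
    Matrix.reindex (sumToBP (rfl : De = De)) (sumToBP rfl) (Matrix.fromBlocks 0 a a 0) =
      (pauliX ^ 1) ⊗ₖ a := by
  ext ⟨x, k⟩ ⟨y, l⟩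
  cases x <;> cases y <;> simp [sumToBP, pauliX, Matrix.kroneckerMap_apply, Matrix.fromBlocks]

theorem reindex_sumToBP_parity {De : ℕ} :
    Matrix.reindex (sumToBP (rfl : De = De)) (sumToBP rfl)
      (Matrix.fromBlocks (1 : Matrix (Fin De) (Fin De) ℂ) 0 0 (-1)) =
      pauliZ ⊗ₖ (1 : Matrix (Fin De) (Fin De) ℂ) := by
  ext ⟨x, k⟩ ⟨y, l⟩
  cases x <;> cases y <;> simp [sumToBP, pauliZ, Matrix.kroneckerMap_apply, Matrix.fromBlocks]

/-- A graded normal degenerate tensor has `D_e = D_o` and, up to an even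
gauge, the form `A^i = (σˣ)^{|i|} ⊗ B^i`; moreover some `B^i` with `|i| = 1` and some
`B^j` with `|j| = 0` are nonzero. -/
theorem graded_normal_degenerate_form {d De Do : ℕ} (p : Fin d → ZMod 2)
    (Z : Matrix (Fin De ⊕ Fin Do) (Fin De ⊕ Fin Do) ℂ)
    (hZ : Z = Matrix.fromBlocks (1 : Matrix (Fin De) (Fin De) ℂ) 0 0
        (-(1 : Matrix (Fin Do) (Fin Do) ℂ)))
    (A : Fin d → Matrix (Fin De ⊕ Fin Do) (Fin De ⊕ Fin Do) ℂ)
    (hA : EvenTensor p A Z)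
    (hnorm : GradedNormal A Z 2) :
    ∃ h : Do = De,
      ∃ Y : Matrix (Fin De ⊕ Fin Do) (Fin De ⊕ Fin Do) ℂ,
        IsUnit Y ∧ Y * Z = Z * Y ∧
        ∃ B : Fin d → Matrix (Fin De) (Fin De) ℂ,
          Matrix.reindex (sumToBP h) (sumToBP h) Z =
            pauliZ ⊗ₖ (1 : Matrix (Fin De) (Fin De) ℂ) ∧
          (∀ i, Matrix.reindex (sumToBP h) (sumToBP h) (Y * A i * Y⁻¹) =
            (pauliX ^ (p i).val) ⊗ₖ B i) ∧
          (∃ i, p i = 1 ∧ B i ≠ 0) ∧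
          (∃ j, p j = 0 ∧ B j ≠ 0) := by
  subst hZ
  have hZ := conjTranspose_blockParity (m := Fin De) (n := Fin Do)
  have hZZ := blockParity_mul_self (m := Fin De) (n := Fin Do)
  obtain ⟨X, hXX, hXZ, hAX⟩ := hA.exists_odd_involution hZ hZZ hnorm
  obtain ⟨P, Q, rfl, hPQ, hQP⟩ := exists_fromBlocks_of_odd_involution hXX hXZ
  have hdim : Do = De := by
    have h := Matrix.trace_mul_comm Q P
    rw [hPQ, hQP, Matrix.trace_one, Matrix.trace_one, Fintype.card_fin, Fintype.card_fin] at h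
    exact_mod_cast h
  subst hdim
  have hne := hnorm.nonempty two_ne_zero
  have : Nonempty (Fin Do) := by
    obtain ⟨x | x⟩ := hne
    exacts [⟨x⟩, ⟨x⟩]
  have hYY : Matrix.fromBlocks (1 : Matrix (Fin Do) (Fin Do) ℂ) 0 0 P *
      Matrix.fromBlocks 1 0 0 Q = 1 := by
    simp [Matrix.fromBlocks_multiply, hPQ, Matrix.fromBlocks_one]
  have hinv := Matrix.inv_eq_right_inv hYY
  have hYunit := IsUnit.of_mul_eq_one _ hYY
  set Y := Matrix.fromBlocks (1 : Matrix (Fin Do) (Fin Do) ℂ) 0 0 P with hY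
  let B : Fin d → Matrix (Fin Do) (Fin Do) ℂ := fun i =>
    if p i = 0 then (A i).toBlocks₁₁ else (A i).toBlocks₁₂ * Q
  have hB : ∀ i, Matrix.reindex (sumToBP rfl) (sumToBP rfl) (Y * A i * Y⁻¹) =
      (pauliX ^ (p i).val) ⊗ₖ B i := fun i => by
    rw [hinv]
    rcases (by decide : ∀ x : ZMod 2, x = 0 ∨ x = 1) (p i) with hi | hi
    · rw [hY, conj_fromBlocks_of_even hPQ (by simpa [hi, sgn] using hA i) (hAX i),
        reindex_sumToBP_even]
      simp [B, hi]
    · rw [hY, conj_fromBlocks_of_odd (by simpa [hi, sgn, ZMod.val_one] using hA i) (hAX i),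
        reindex_sumToBP_odd]
      simp [B, hi, ZMod.val_one]
  have hBne : ∀ i, A i ≠ 0 → B i ≠ 0 := fun i hi h₀ => hi <| by
    have h := hB i
    rw [h₀, Matrix.kroneckerMap_zero_right _ (by simp)] at h
    have h₁ : Y * A i * Y⁻¹ = 0 :=
      (Matrix.reindex (sumToBP rfl) (sumToBP rfl)).injective (h.trans (by simp))
    have hYinv : Y⁻¹ * Y = 1 :=
      Matrix.nonsing_inv_mul Y ((Matrix.isUnit_iff_isUnit_det Y).mp hYunit)
    calc A i = Y⁻¹ * (Y * A i * Y⁻¹) * Y := by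
          rw [Matrix.mul_assoc, Matrix.mul_assoc, hYinv, Matrix.mul_one, ← Matrix.mul_assoc,
            hYinv, Matrix.one_mul]
      _ = 0 := by rw [h₁, Matrix.mul_zero, Matrix.zero_mul]
  obtain ⟨i, hi, hAi⟩ := hnorm.1.exists_odd_ne_zero hA
  obtain ⟨j, hj, hAj⟩ := hA.exists_even_ne_zero hZ hZZ hnorm two_ne_zero
  refine ⟨rfl, Y, hYunit, ?_, B, reindex_sumToBP_parity, hB, ⟨i, hi, hBne i hAi⟩,
    ⟨j, hj, hBne j hAj⟩⟩
  simp [hY, Matrix.fromBlocks_multiply]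

end

end FQCA
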